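/- Every signed complete graph on 4 vertices is switching-isomorphic to exactly one of the following three signed graphs: K₄⁺ (the complete graph on 4 vertices with all edges positive), K₄⁻ (the complete graph on 4 vertices with all edges negative), and K₄^mixed (the complete graph on 4 vertices with exactly one negative edge); in particular, these three signed graphs are pairwise non-switching-isomorphic. -/

import Mathlib

open SimpleGraph

/-- Two signatures on a graph `G` are equivalent (`σ₂` is obtained from `σ₁` by
switching the set of vertices `{v | s v = true}`); signs are encoded by `Bool`,
with `true` meaning negative, so that the product of signs is `xor`. -/
def SigEquiv {V : Type*} (G : SimpleGraph V) (σ₁ σ₂ : V → V → Bool) : Prop :=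
  ∃ s : V → Bool, ∀ u v, G.Adj u v → σ₂ u v = xor (σ₁ u v) (xor (s u) (s v))

/-- Switching isomorphism of signed graphs: an isomorphism of the underlying
graphs carrying one signature to a signature equivalent to the other. -/
def SSwitchIso {V W : Type*} (G : SimpleGraph V) (σ : V → V → Bool)
    (H : SimpleGraph W) (π : W → W → Bool) : Prop :=
  ∃ (e : G ≃g H) (s : V → Bool),
    ∀ u v, G.Adj u v → π (e u) (e v) = xor (σ u v) (xor (s u) (s v))

/-- The signature of `K₄^mixed`: the complete graph on four vertices with
exactly one negative edge (the edge `01`). -/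
def K4mixedSign : Fin 4 → Fin 4 → Bool :=
  fun u v => (u == 0 && v == 1) || (u == 1 && v == 0)

/-- The sign of a triangle is invariant under switching, so a switching isomorphism between
complete graphs matches every triangle of the target with one of the same sign in the source. -/
theorem SSwitchIso.exists_triangle {V W : Type*} {σ : V → V → Bool} {π : W → W → Bool}
    (h : SSwitchIso (⊤ : SimpleGraph V) σ (⊤ : SimpleGraph W) π) {a b c : W}
    (hab : a ≠ b) (hac : a ≠ c) (hbc : b ≠ c) :
    ∃ x y z : V, xor (π a b) (xor (π a c) (π b c)) = xor (σ x y) (xor (σ x z) (σ y z)) := by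
  obtain ⟨e, s, h⟩ := h
  refine ⟨e.symm a, e.symm b, e.symm c, ?_⟩
  have h₁ := h (e.symm a) (e.symm b) (by simpa using hab)
  have h₂ := h (e.symm a) (e.symm c) (by simpa using hac)
  have h₃ := h (e.symm b) (e.symm c) (by simpa using hbc)
  simp only [RelIso.apply_symm_apply] at h₁ h₂ h₃
  rw [h₁, h₂, h₃]
  generalize s (e.symm a) = p, s (e.symm b) = q, s (e.symm c) = r
  cases p <;> cases q <;> cases r <;> simp

/-- Switching isomorphisms can be precomposed with a relabelling and a switching of the source. -/
theorem SSwitchIso.of_relabel_switch {V U W : Type*} {σ : V → V → Bool} {τ : U → U → Bool}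
    {π : W → W → Bool} (f : V ≃ U) (t : V → Bool)
    (hτ : ∀ u v, u ≠ v → τ (f u) (f v) = xor (σ u v) (xor (t u) (t v)))
    (h : SSwitchIso (⊤ : SimpleGraph U) τ (⊤ : SimpleGraph W) π) :
    SSwitchIso (⊤ : SimpleGraph V) σ (⊤ : SimpleGraph W) π := by
  obtain ⟨e, s, h⟩ := h
  refine ⟨(Iso.completeGraph f).trans e, fun v => xor (t v) (s (f v)), fun u v huv => ?_⟩
  have huv' : u ≠ v := by simpa using huv
  have key := h (f u) (f v) (by simpa using huv')
  rw [hτ u v huv'] at key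
  refine key.trans ?_
  simp only [Bool.xor_assoc, Bool.xor_left_comm]

/-- The signature on four vertices in which all edges at `0` are positive and the edges
`12`, `13`, `23` have signs `x`, `y`, `z`. -/
def rootedSign (x y z : Bool) (u v : Fin 4) : Bool :=
  if u = 0 ∨ v = 0 then false
  else if u = 3 ∨ v = 3 then (if u = 2 ∨ v = 2 then z else y)
  else x

/-- A symmetric signature with all edges at `0` positive is a `rootedSign` off the diagonal. -/
theorem rootedSign_eq {τ : Fin 4 → Fin 4 → Bool} (hτ : ∀ i j, τ i j = τ j i)
    (h₀ : ∀ j, j ≠ 0 → τ 0 j = false) {i j : Fin 4} (hij : i ≠ j) :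
    rootedSign (τ 1 2) (τ 1 3) (τ 2 3) i j = τ i j := by
  have h₁ := h₀ 1 (by decide)
  have h₂ := h₀ 2 (by decide)
  have h₃ := h₀ 3 (by decide)
  fin_cases i <;> fin_cases j <;>
    simp [rootedSign, h₁, h₂, h₃, hτ 1 0, hτ 2 0, hτ 3 0, hτ 2 1, hτ 3 1, hτ 3 2] at hij ⊢

theorem rootedSign_classification (x y z : Bool) :
    SSwitchIso (⊤ : SimpleGraph (Fin 4)) (rootedSign x y z)
        (⊤ : SimpleGraph (Fin 4)) (fun _ _ => false) ∨
      SSwitchIso (⊤ : SimpleGraph (Fin 4)) (rootedSign x y z)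
        (⊤ : SimpleGraph (Fin 4)) (fun _ _ => true) ∨
      SSwitchIso (⊤ : SimpleGraph (Fin 4)) (rootedSign x y z)
        (⊤ : SimpleGraph (Fin 4)) K4mixedSign := by
  have key : ∀ x y z : Bool,
      (∃ s : Fin 4 → Bool, ∀ u v, u ≠ v →
        false = xor (rootedSign x y z u v) (xor (s u) (s v))) ∨
      (∃ s : Fin 4 → Bool, ∀ u v, u ≠ v →
        true = xor (rootedSign x y z u v) (xor (s u) (s v))) ∨
      ∃ (i j : Fin 4) (s : Fin 4 → Bool), ∀ u v, u ≠ v →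
        K4mixedSign ((Equiv.swap 0 i * Equiv.swap 1 j) u) ((Equiv.swap 0 i * Equiv.swap 1 j) v) =
          xor (rootedSign x y z u v) (xor (s u) (s v)) := by
    decide
  rcases key x y z with ⟨s, h⟩ | ⟨s, h⟩ | ⟨i, j, s, h⟩
  · exact .inl ⟨Iso.refl, s, fun u v huv => h u v huv⟩
  · exact .inr (.inl ⟨Iso.refl, s, fun u v huv => h u v huv⟩)
  · exact .inr (.inr ⟨Iso.completeGraph (Equiv.swap 0 i * Equiv.swap 1 j), s,
      fun u v huv => h u v huv⟩)

/-- Every signed complete graph on four vertices is switching-isomorphic to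
one of `K₄⁺`, `K₄⁻`, `K₄^mixed`, and these three are pairwise
non-switching-isomorphic. -/
theorem signed_K4_classification :
    (∀ (V : Type) [Fintype V], Fintype.card V = 4 →
      ∀ σ : V → V → Bool, (∀ u v, σ u v = σ v u) →
        (SSwitchIso (⊤ : SimpleGraph V) σ (⊤ : SimpleGraph (Fin 4)) (fun _ _ => false) ∨
         SSwitchIso (⊤ : SimpleGraph V) σ (⊤ : SimpleGraph (Fin 4)) (fun _ _ => true) ∨
         SSwitchIso (⊤ : SimpleGraph V) σ (⊤ : SimpleGraph (Fin 4)) K4mixedSign)) ∧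
    ¬ SSwitchIso (⊤ : SimpleGraph (Fin 4)) (fun _ _ => false)
        (⊤ : SimpleGraph (Fin 4)) (fun _ _ => true) ∧
    ¬ SSwitchIso (⊤ : SimpleGraph (Fin 4)) (fun _ _ => false)
        (⊤ : SimpleGraph (Fin 4)) K4mixedSign ∧
    ¬ SSwitchIso (⊤ : SimpleGraph (Fin 4)) (fun _ _ => true)
        (⊤ : SimpleGraph (Fin 4)) K4mixedSign := by
  refine ⟨fun V _ hV σ hσ => ?_, fun h => ?_, fun h => ?_, fun h => ?_⟩
  · obtain ⟨f⟩ : Nonempty (V ≃ Fin 4) := ⟨Fintype.equivFinOfCardEq hV⟩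
    let t : V → Bool := fun v => if f v = 0 then false else σ (f.symm 0) v
    let τ : Fin 4 → Fin 4 → Bool := fun i j =>
      xor (σ (f.symm i) (f.symm j)) (xor (t (f.symm i)) (t (f.symm j)))
    have hf : ∀ u v, u ≠ v →
        rootedSign (τ 1 2) (τ 1 3) (τ 2 3) (f u) (f v) = xor (σ u v) (xor (t u) (t v)) := by
      intro u v huv
      have hτ : ∀ i j, τ i j = τ j i := fun i j => by
        simp only [τ]
        rw [hσ, Bool.xor_comm (t _)]
      rw [rootedSign_eq hτ (fun j hj => by simp [τ, t, hj]) (f.injective.ne huv)]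
      simp [τ]
    exact (rootedSign_classification _ _ _).imp (.of_relabel_switch f t hf)
      (.imp (.of_relabel_switch f t hf) (.of_relabel_switch f t hf))
  · obtain ⟨_, _, _, h⟩ := h.exists_triangle (a := 0) (b := 1) (c := 2)
      (by decide) (by decide) (by decide)
    simp at h
  · obtain ⟨_, _, _, h⟩ := h.exists_triangle (a := 0) (b := 1) (c := 2)
      (by decide) (by decide) (by decide)
    simp [K4mixedSign] at h
  · obtain ⟨_, _, _, h⟩ := h.exists_triangle (a := 0) (b := 2) (c := 3)
      (by decide) (by decide) (by decide)
    simp [K4mixedSign] at h
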